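/- Let μ be a Borel probability measure on 𝕋² × S¹ that is invariant under the geodesic flow φ^t(x,θ) = (x + tθ, θ) for every t ∈ ℝ. Let Ω₂ ∩ S¹ = {θ ∈ S¹ : k·θ ≠ 0 for every k ∈ ℤ² \ {0}} be the set of irrational directions, and let p : 𝕋² × S¹ → S¹ be the projection p(x,θ) = θ. Then the restriction of μ to 𝕋² × (Ω₂ ∩ S¹) coincides with the restriction of Leb_{𝕋²} ⊗ p_*μ to 𝕋² × (Ω₂ ∩ S¹), where Leb_{𝕋²} is the Lebesgue (Haar) probability measure on 𝕋² and p_*μ is the pushforward of μ under p. -/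

import Mathlib

open MeasureTheory Filter Topology
open scoped Real ENNReal

noncomputable section

/-- The torus `𝕋² = ℝ²/ℤ²`. -/
abbrev T2 : Type := UnitAddCircle × UnitAddCircle

/-- The unit circle `S¹ ⊂ ℝ²` of directions. -/
abbrev Sph : Type := Metric.sphere (0 : EuclideanSpace ℝ (Fin 2)) 1

/-- The geodesic flow `φ^t(x,θ) = (x + tθ, θ)` on `𝕋² × S¹`. -/
def geoFlow (t : ℝ) (p : T2 × Sph) : T2 × Sph :=
  ((p.1.1 + ↑(t * (p.2 : EuclideanSpace ℝ (Fin 2)) 0),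
    p.1.2 + ↑(t * (p.2 : EuclideanSpace ℝ (Fin 2)) 1)), p.2)

/-- A direction `θ ∈ S¹` is irrational if `k·θ ≠ 0` for every `k ∈ ℤ² \ {0}`. -/
def IrrDir (θ : Sph) : Prop :=
  ∀ k : ℤ × ℤ, k ≠ 0 →
    (k.1 : ℝ) * (θ : EuclideanSpace ℝ (Fin 2)) 0 +
      (k.2 : ℝ) * (θ : EuclideanSpace ℝ (Fin 2)) 1 ≠ 0

end

theorem ContinuousMap.integral_eq_of_span_dense {X : Type*} [TopologicalSpace X] [CompactSpace X]
    [MeasurableSpace X] [BorelSpace X] {μ ν : Measure X} [IsFiniteMeasure μ] [IsFiniteMeasure ν]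
    {S : Set C(X, ℂ)} (hS : (Submodule.span ℂ S).topologicalClosure = ⊤)
    (h : ∀ f ∈ S, ∫ x, f x ∂μ = ∫ x, f x ∂ν) (f : C(X, ℂ)) :
    ∫ x, f x ∂μ = ∫ x, f x ∂ν := by
  have hint (ρ : Measure X) [IsFiniteMeasure ρ] (f : C(X, ℂ)) : Integrable f ρ :=
    f.continuous.integrable_of_hasCompactSupport (HasCompactSupport.of_compactSpace _)
  let L (ρ : Measure X) [IsFiniteMeasure ρ] : C(X, ℂ) →L[ℂ] ℂ :=
    LinearMap.mkContinuous
      { toFun := fun f => ∫ x, f x ∂ρ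
        map_add' := fun f g => integral_add (hint ρ f) (hint ρ g)
        map_smul' := fun c f => integral_const_mul c f }
      (ρ.real Set.univ) fun f => by
        rw [mul_comm]
        exact norm_integral_le_of_norm_le_const (ae_of_all _ f.norm_coe_le_norm)
  have hL : L μ = L ν :=
    ContinuousLinearMap.ext_on (Submodule.dense_iff_topologicalClosure_eq_top.mpr hS) h
  exact DFunLike.congr_fun hL f

/-- A finite measure on the torus is determined by its Fourier coefficients. -/
theorem UnitAddTorus.ext_of_forall_integral_mFourier_eq {d : Type*} [Fintype d]
    {μ ν : Measure (UnitAddTorus d)} [IsFiniteMeasure μ] [IsFiniteMeasure ν]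
    (h : ∀ n : d → ℤ, ∫ x, mFourier n x ∂μ = ∫ x, mFourier n x ∂ν) : μ = ν := by
  refine ext_of_forall_integral_eq_of_IsFiniteMeasure fun f => ?_
  have := ContinuousMap.integral_eq_of_span_dense span_mFourier_closure_eq_top
    (Set.forall_mem_range.mpr h) ⟨fun x => (f x : ℂ), by fun_prop⟩
  simpa [integral_complex_ofReal] using this

theorem T2.ext_of_forall_integral_fourier_eq {μ ν : Measure T2}
    [IsFiniteMeasure μ] [IsFiniteMeasure ν]
    (h : ∀ m n : ℤ, ∫ x, fourier m x.1 * fourier n x.2 ∂μ = ∫ x, fourier m x.1 * fourier n x.2 ∂ν) :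
    μ = ν := by
  let e : UnitAddTorus (Fin 2) ≃ᵐ T2 := MeasurableEquiv.finTwoArrow
  refine e.symm.map_measurableEquiv_injective
    (UnitAddTorus.ext_of_forall_integral_mFourier_eq fun k => ?_)
  rw [integral_map_equiv, integral_map_equiv]
  simpa [UnitAddTorus.mFourier, Fin.prod_univ_two, e] using h (k 0) (k 1)

theorem UnitAddCircle.integral_fourier_of_ne_zero {n : ℤ} (hn : n ≠ 0) :
    ∫ x : UnitAddCircle, fourier n x = 0 := by
  have h := congrFun (fourierCoeff_fourier (T := 1) n) 0
  rw [Pi.single_eq_of_ne hn.symm, fourierCoeff] at h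
  rw [AddCircle.volume_eq_smul_haarAddCircle]
  simpa using h

theorem T2.integral_fourier_of_ne_zero {k : ℤ × ℤ} (hk : k ≠ 0) :
    ∫ x : T2, fourier k.1 x.1 * fourier k.2 x.2 = 0 := by
  rw [Measure.volume_eq_prod,
    integral_prod_mul (fun x : UnitAddCircle => (fourier k.1 x : ℂ)) (fun x => fourier k.2 x)]
  by_cases h : k.1 = 0
  · rw [UnitAddCircle.integral_fourier_of_ne_zero fun h' => hk (Prod.ext h h'), mul_zero]
  · rw [UnitAddCircle.integral_fourier_of_ne_zero h, zero_mul]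

theorem continuous_geoFlow (t : ℝ) : Continuous (geoFlow t) := by
  have (a : ℝ) : Continuous ((↑) : ℝ → AddCircle a) := AddCircle.continuous_mk' a
  unfold geoFlow
  fun_prop

theorem measurableSet_irrDir : MeasurableSet {θ : Sph | IrrDir θ} := by
  simp only [IrrDir, Set.ofPred_forall]
  refine MeasurableSet.iInter fun k => MeasurableSet.iInter fun _ => ?_
  exact (isOpen_ne_fun (by fun_prop) (by fun_prop)).measurableSet

/-- The phase `exp(2πi t k·θ)` gained by the character `k` along the flow. -/
noncomputable def flowPhase (t : ℝ) (k : ℤ × ℤ) (θ : Sph) : ℂ :=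
  Complex.exp (2 * π * Complex.I * (t * (k.1 * (θ : EuclideanSpace ℝ (Fin 2)) 0 +
      k.2 * (θ : EuclideanSpace ℝ (Fin 2)) 1) : ℝ))

theorem continuous_flowPhase (t : ℝ) (k : ℤ × ℤ) : Continuous (flowPhase t k) := by
  unfold flowPhase
  fun_prop

theorem fourier_mul_fourier_geoFlow (t : ℝ) (k : ℤ × ℤ) (p : T2 × Sph) :
    (fourier k.1 (geoFlow t p).1.1 * fourier k.2 (geoFlow t p).1.2 : ℂ) =
      fourier k.1 p.1.1 * fourier k.2 p.1.2 * flowPhase t k p.2 := by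
  have hadd (n : ℤ) (x y : UnitAddCircle) :
      (fourier n (x + y) : ℂ) = fourier n x * fourier n y := by
    simp [fourier_apply, AddCircle.toCircle_add]
  have hphase : flowPhase t k p.2 =
      fourier k.1 ((t * (p.2 : EuclideanSpace ℝ (Fin 2)) 0 : ℝ) : UnitAddCircle) *
        fourier k.2 ((t * (p.2 : EuclideanSpace ℝ (Fin 2)) 1 : ℝ) : UnitAddCircle) := by
    rw [fourier_coe_apply, fourier_coe_apply, ← Complex.exp_add, flowPhase]
    congr 1
    push_cast
    ring
  simp only [geoFlow, hadd, hphase]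
  ring

/-- Since `k·θ` is bounded on the circle, a single small time detects `k·θ ≠ 0`. -/
theorem exists_flowPhase_ne_one {k : ℤ × ℤ} (hk : k ≠ 0) :
    ∃ t : ℝ, ∀ θ : Sph, IrrDir θ → flowPhase t k θ ≠ 1 := by
  set C : ℝ := |(k.1 : ℝ)| + |(k.2 : ℝ)| + 1
  have hC : 0 < C := by positivity
  refine ⟨C⁻¹, fun θ hθ h => ?_⟩
  have hcoord (i : Fin 2) : |(θ : EuclideanSpace ℝ (Fin 2)) i| ≤ 1 := by
    simpa using PiLp.norm_apply_le (θ : EuclideanSpace ℝ (Fin 2)) i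
  have hw := hθ k hk
  set w : ℝ := k.1 * (θ : EuclideanSpace ℝ (Fin 2)) 0 + k.2 * (θ : EuclideanSpace ℝ (Fin 2)) 1
  have hwC : |w| < C := by
    calc |w| ≤ |(k.1 : ℝ)| * |(θ : EuclideanSpace ℝ (Fin 2)) 0| +
          |(k.2 : ℝ)| * |(θ : EuclideanSpace ℝ (Fin 2)) 1| := by
          rw [← abs_mul, ← abs_mul]
          exact abs_add_le _ _
      _ ≤ |(k.1 : ℝ)| * 1 + |(k.2 : ℝ)| * 1 := by gcongr <;> exact hcoord _
      _ < C := by simp [C]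
  obtain ⟨n, hn⟩ := Complex.exp_eq_one_iff.mp h
  have hn' : C⁻¹ * w = n := by
    have : ((C⁻¹ * w : ℝ) : ℂ) = ((n : ℝ) : ℂ) := by
      apply mul_left_cancel₀ Complex.two_pi_I_ne_zero
      rw [hn]
      push_cast
      ring
    exact_mod_cast this
  have hlt : |(n : ℝ)| < 1 := by
    rw [← hn', abs_mul, abs_of_pos (inv_pos.mpr hC), inv_mul_lt_one₀ hC]
    exact hwC
  have hn0 : n = 0 := Int.abs_lt_one_iff.mp (by exact_mod_cast hlt)
  rw [hn0, Int.cast_zero, mul_eq_zero] at hn'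
  exact hn'.elim (inv_ne_zero hC.ne') hw

section Invariant

variable {μ : Measure (T2 × Sph)} [IsFiniteMeasure μ]

theorem norm_fourier_mul_fourier (k : ℤ × ℤ) (x : T2) :
    ‖(fourier k.1 x.1 * fourier k.2 x.2 : ℂ)‖ = 1 := by
  simp only [fourier_apply, norm_mul, Circle.norm_coe, mul_one]

theorem integrable_fourier_mul_fourier (k : ℤ × ℤ) (μ : Measure (T2 × Sph)) [IsFiniteMeasure μ] :
    Integrable (fun p : T2 × Sph => (fourier k.1 p.1.1 * fourier k.2 p.1.2 : ℂ)) μ :=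
  Continuous.integrable_of_hasCompactSupport (by fun_prop) (HasCompactSupport.of_compactSpace _)

theorem setIntegral_fourier_eq_zero_of_le_norm {t : ℝ} (hinv : μ.map (geoFlow t) = μ)
    (k : ℤ × ℤ) {B : Set Sph} (hB : MeasurableSet B) {ε : ℝ} (hε : 0 < ε)
    (hBε : ∀ θ ∈ B, ε ≤ ‖flowPhase t k θ - 1‖) :
    ∫ p in Prod.snd ⁻¹' B, (fourier k.1 p.1.1 * fourier k.2 p.1.2 : ℂ) ∂μ = 0 := by
  set g : T2 × Sph → ℂ := fun p => fourier k.1 p.1.1 * fourier k.2 p.1.2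
  have hg : Measurable g := by fun_prop
  have hz : Measurable (flowPhase t k) := (continuous_flowPhase t k).measurable
  set h : Sph → ℂ := B.indicator fun θ => (flowPhase t k θ - 1)⁻¹
  have hh : Measurable h := ((hz.sub_const 1).inv).indicator hB
  have hF : Measurable fun p : T2 × Sph => g p * h p.2 := by fun_prop
  have hbound (p : T2 × Sph) : ‖g p * h p.2‖ ≤ ε⁻¹ := by
    rw [norm_mul, norm_fourier_mul_fourier, one_mul]
    by_cases hp : p.2 ∈ B
    · simp only [h, Set.indicator_of_mem hp, norm_inv]
      exact inv_anti₀ hε (hBε _ hp)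
    · simp [h, Set.indicator_of_notMem hp, hε.le]
  have hφ : Measurable (geoFlow t) := (continuous_geoFlow t).measurable
  have hFint : Integrable (fun p : T2 × Sph => g p * h p.2) μ :=
    .of_bound hF.aestronglyMeasurable _ (ae_of_all _ hbound)
  have hFint' : Integrable (fun p : T2 × Sph => g (geoFlow t p) * h (geoFlow t p).2) μ :=
    .of_bound (hF.comp hφ).aestronglyMeasurable _ (ae_of_all _ fun p => hbound (geoFlow t p))
  have hflow : ∫ p, g (geoFlow t p) * h (geoFlow t p).2 ∂μ = ∫ p, g p * h p.2 ∂μ := by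
    conv_rhs => rw [← hinv]
    exact (integral_map hφ.aemeasurable hF.aestronglyMeasurable).symm
  rw [← sub_eq_zero, ← integral_sub hFint' hFint] at hflow
  rw [← integral_indicator (measurable_snd hB), ← hflow]
  congr 1 with p
  have hgp : g (geoFlow t p) = g p * flowPhase t k p.2 := fourier_mul_fourier_geoFlow t k p
  have hsnd : (geoFlow t p).2 = p.2 := rfl
  rw [hgp, hsnd]
  by_cases hp : p.2 ∈ B
  · have hne : flowPhase t k p.2 - 1 ≠ 0 := norm_pos_iff.mp (hε.trans_le (hBε _ hp))
    rw [Set.indicator_of_mem (show p ∈ Prod.snd ⁻¹' B from hp)]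
    simp only [h, Set.indicator_of_mem hp]
    field_simp
    rfl
  · rw [Set.indicator_of_notMem (show p ∉ Prod.snd ⁻¹' B from hp)]
    simp [h, Set.indicator_of_notMem hp]

/-- Over irrational directions, an invariant measure has no nonzero Fourier modes. -/
theorem setIntegral_fourier_eq_zero (hinv : ∀ t : ℝ, μ.map (geoFlow t) = μ)
    {k : ℤ × ℤ} (hk : k ≠ 0) {B : Set Sph} (hB : MeasurableSet B) (hBirr : ∀ θ ∈ B, IrrDir θ) :
    ∫ p in Prod.snd ⁻¹' B, (fourier k.1 p.1.1 * fourier k.2 p.1.2 : ℂ) ∂μ = 0 := by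
  obtain ⟨t, ht⟩ := exists_flowPhase_ne_one hk
  have hz : Measurable (flowPhase t k) := (continuous_flowPhase t k).measurable
  let S (n : ℕ) : Set Sph := B ∩ {θ | 1 / ((n : ℝ) + 1) ≤ ‖flowPhase t k θ - 1‖}
  have hS (n : ℕ) : MeasurableSet (S n) :=
    hB.inter (measurableSet_le measurable_const (by fun_prop))
  have hmono : Monotone S := fun m n hmn => Set.inter_subset_inter_right _ fun θ hθ =>
    (Nat.one_div_le_one_div hmn).trans (Set.mem_ofPred_eq ▸ hθ)
  have hunion : ⋃ n, S n = B := by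
    refine subset_antisymm (Set.iUnion_subset fun n => Set.inter_subset_left) fun θ hθ => ?_
    obtain ⟨n, hn⟩ := exists_nat_one_div_lt
      (norm_pos_iff.mpr (sub_ne_zero.mpr (ht θ (hBirr θ hθ))))
    exact Set.mem_iUnion.mpr ⟨n, hθ, hn.le⟩
  have hlim := tendsto_setIntegral_of_monotone (μ := μ)
    (f := fun p : T2 × Sph => (fourier k.1 p.1.1 * fourier k.2 p.1.2 : ℂ))
    (fun n => measurable_snd (hS n)) (fun m n hmn => Set.preimage_mono (hmono hmn))
    (integrable_fourier_mul_fourier k μ).integrableOn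
  rw [← Set.preimage_iUnion, hunion] at hlim
  refine tendsto_nhds_unique hlim (tendsto_const_nhds.congr fun n => ?_)
  exact (setIntegral_fourier_eq_zero_of_le_norm (hinv t) k (hS n) Nat.one_div_pos_of_nat
    fun θ hθ => hθ.2).symm

theorem map_fst_restrict_eq_smul_volume (hinv : ∀ t : ℝ, μ.map (geoFlow t) = μ)
    {B : Set Sph} (hB : MeasurableSet B) (hBirr : ∀ θ ∈ B, IrrDir θ) :
    (μ.restrict (Prod.snd ⁻¹' B)).map Prod.fst = μ (Prod.snd ⁻¹' B) • (volume : Measure T2) := by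
  have : IsFiniteMeasure (μ (Prod.snd ⁻¹' B) • (volume : Measure T2)) :=
    Measure.smul_finite _ (measure_ne_top _ _)
  refine T2.ext_of_forall_integral_fourier_eq fun m n => ?_
  have hcont : Continuous fun x : T2 => (fourier m x.1 * fourier n x.2 : ℂ) := by fun_prop
  rw [integral_map measurable_fst.aemeasurable hcont.measurable.aestronglyMeasurable,
    integral_smul_measure]
  by_cases hk : ((m, n) : ℤ × ℤ) = 0
  · obtain ⟨rfl, rfl⟩ := Prod.mk_eq_zero.mp hk
    have huniv : (volume : Measure T2) Set.univ = 1 := by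
      rw [Measure.volume_eq_prod, ← Set.univ_prod_univ, Measure.prod_prod,
        UnitAddCircle.measure_univ, one_mul]
    simp [Measure.real, huniv]
  · rw [setIntegral_fourier_eq_zero hinv hk hB hBirr, T2.integral_fourier_of_ne_zero hk, smul_zero]

end Invariant

/-- Lemma 5.2, after Anantharaman–Macià: on the set of irrational
directions, any geodesic-flow invariant probability measure on `𝕋² × S¹` is the product
of the Lebesgue measure on `𝕋²` with its direction marginal. -/
theorem statement14
    (μ : Measure (T2 × Sph)) (hprob : IsProbabilityMeasure μ)
    (hinv : ∀ t : ℝ, Measure.map (geoFlow t) μ = μ) :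
    μ.restrict {p : T2 × Sph | IrrDir p.2} =
      ((volume : Measure T2).prod (μ.map Prod.snd)).restrict {p : T2 × Sph | IrrDir p.2} := by
  refine Measure.ext_prod fun {A B} hA hB => ?_
  have hBirr : MeasurableSet (B ∩ {θ | IrrDir θ}) := hB.inter measurableSet_irrDir
  have hset : A ×ˢ B ∩ {p : T2 × Sph | IrrDir p.2} = A ×ˢ (B ∩ {θ | IrrDir θ}) := by
    ext p
    simp [and_assoc]
  have h := DFunLike.congr_fun (map_fst_restrict_eq_smul_volume hinv hBirr fun θ hθ => hθ.2) A
  rw [Measure.map_apply measurable_fst hA, Measure.restrict_apply (measurable_fst hA),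
    Measure.smul_apply, smul_eq_mul] at h
  rw [Measure.restrict_apply (hA.prod hB), Measure.restrict_apply (hA.prod hB), hset,
    Measure.prod_prod, Measure.map_apply measurable_snd hBirr, mul_comm, ← h, Set.prod_eq]
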